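/- Let R be a right noetherian ring, let H be a monoform right R-module, let E be a nonzero indecomposable injective right R-module containing a submodule isomorphic to H, and let f : H → E be an R-homomorphism. Then f is either zero or injective, and the image of f is contained in the unique maximal monoform submodule H_E of E (where H_E is the intersection of the kernels of all endomorphisms of E that are not automorphisms). -/

import Mathlib

universe u v w

/-- A module `M` over `A` is *monoform* if it is nonzero and for every nonzero submodule `N`
of `M` there is no nonzero submodule of `M` isomorphic to a submodule of `M ⧸ N`.
A right `R`-module is a module over `Rᵐᵒᵖ`. -/
def IsMonoform (A : Type u) [Ring A] (M : Type v) [AddCommGroup M] [Module A M] : Prop :=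
  Nontrivial M ∧ ∀ N : Submodule A M, N ≠ ⊥ →
    ¬ ∃ (C : Submodule A M) (f : C →ₗ[A] M ⧸ N), C ≠ ⊥ ∧ Function.Injective f

/-- A module is *indecomposable* if it is nonzero and is not the direct sum of two nonzero
submodules. -/
def IsIndecomposableModule (A : Type u) [Ring A] (M : Type v) [AddCommGroup M] [Module A M] :
    Prop :=
  Nontrivial M ∧
    ¬ ∃ N₁ N₂ : Submodule A M, N₁ ≠ ⊥ ∧ N₂ ≠ ⊥ ∧ N₁ ⊓ N₂ = ⊥ ∧ N₁ ⊔ N₂ = ⊤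

theorem LinearMap.range_ne_bot_of_injective {S : Type u} [Ring S] {M : Type v} [AddCommGroup M]
    [Module S M] [Nontrivial M] {N : Type w} [AddCommGroup N] [Module S N] {f : M →ₗ[S] N}
    (hf : Function.Injective f) : LinearMap.range f ≠ ⊥ := by
  intro h
  obtain ⟨x, hx⟩ := exists_ne (0 : M)
  rw [LinearMap.range_eq_bot] at h
  exact hx (hf (by simp [h]))

/-- Every submodule disjoint from `A` is contained in one maximal with that property. -/
theorem Submodule.exists_le_maximal_disjoint {S : Type u} [Ring S] {M : Type v} [AddCommGroup M]
    [Module S M] (A B : Submodule S M) (h : Disjoint A B) :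
    ∃ B', B ≤ B' ∧ Maximal (fun C : Submodule S M ↦ Disjoint A C) B' :=
  zorn_le_nonempty₀ {C | Disjoint A C} (fun c hc hchain _ _ ↦
    ⟨sSup c, (hchain.directedOn.disjoint_sSup_right).2 fun _ hC ↦ hc hC,
      fun _ hz ↦ le_sSup hz⟩) B h

/-- Two submodules of an injective module, each maximal among the submodules disjoint from the
other, span the module. -/
theorem Module.Injective.sup_eq_top_of_maximal_disjoint {S : Type u} [Ring S] {M : Type v}
    [AddCommGroup M] [Module S M] [Module.Injective S M] {A B : Submodule S M}
    (hB : Maximal (fun C : Submodule S M ↦ Disjoint A C) B)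
    (hA : Maximal (fun C : Submodule S M ↦ Disjoint B C) A) : A ⊔ B = ⊤ := by
  have hinj : Function.Injective (B.mkQ ∘ₗ A.subtype) := by
    rw [← LinearMap.ker_eq_bot, LinearMap.ker_eq_bot']
    intro a ha
    have haB : (a : M) ∈ B := by simpa using ha
    exact Subtype.ext (Submodule.disjoint_def.1 hB.prop a a.2 haB)
  obtain ⟨h, hh⟩ := Module.Injective.out (B.mkQ ∘ₗ A.subtype) hinj A.subtype
  have hhA (a : M) (ha : a ∈ A) : h (B.mkQ a) = a := hh ⟨a, ha⟩
  have hcomap : B.comap (h ∘ₗ B.mkQ) ≤ B := by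
    refine hB.le_of_ge (Submodule.disjoint_def.2 fun x hxA hx ↦ ?_) fun x hx ↦ ?_
    · rw [Submodule.mem_comap, LinearMap.comp_apply, hhA x hxA] at hx
      exact Submodule.disjoint_def.1 hB.prop x hxA hx
    · have : B.mkQ x = 0 := by simpa using hx
      rw [Submodule.mem_comap, LinearMap.comp_apply, this, map_zero]
      exact B.zero_mem
  have hrange : LinearMap.range (h ∘ₗ B.mkQ) ≤ A := by
    refine hA.le_of_ge ?_ fun x hx ↦ ⟨x, hhA x hx⟩
    rw [Submodule.disjoint_def]
    rintro _ hx ⟨y, rfl⟩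
    have hy : B.mkQ y = 0 := by simpa using hcomap hx
    rw [LinearMap.comp_apply, hy, map_zero]
  rw [eq_top_iff]
  intro x _
  have hxA : h (B.mkQ x) ∈ A := hrange ⟨x, rfl⟩
  have hxB : x - h (B.mkQ x) ∈ B := hcomap <| by
    rw [Submodule.mem_comap, LinearMap.comp_apply, map_sub, map_sub, hhA _ hxA, sub_self]
    exact B.zero_mem
  exact Submodule.mem_sup.2 ⟨_, hxA, _, hxB, add_sub_cancel _ _⟩

/-- Indecomposable injective modules are uniform. -/
theorem IsIndecomposableModule.inf_ne_bot {S : Type u} [Ring S] {M : Type v} [AddCommGroup M]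
    [Module S M] [Module.Injective S M] (hM : IsIndecomposableModule S M) {A B : Submodule S M}
    (hA : A ≠ ⊥) (hB : B ≠ ⊥) : A ⊓ B ≠ ⊥ := by
  intro hAB
  obtain ⟨B', hBB', hB'⟩ := Submodule.exists_le_maximal_disjoint A B (disjoint_iff.2 hAB)
  obtain ⟨A', hAA', hA'⟩ := Submodule.exists_le_maximal_disjoint B' A hB'.prop.symm
  have hB'' : Maximal (fun C : Submodule S M ↦ Disjoint A' C) B' :=
    ⟨hA'.prop.symm, fun C hC hle ↦ hB'.le_of_ge (hC.mono_left hAA') hle⟩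
  exact hM.2 ⟨A', B', ne_bot_of_le_ne_bot hA hAA', ne_bot_of_le_ne_bot hB hBB',
    hA'.prop.symm.eq_bot, Module.Injective.sup_eq_top_of_maximal_disjoint hB'' hA'⟩

/-- Injective endomorphisms of an indecomposable injective module are bijective. -/
theorem IsIndecomposableModule.bijective_of_injective {S : Type u} [Ring S] {M : Type v}
    [AddCommGroup M] [Module S M] [Module.Injective S M] (hM : IsIndecomposableModule S M)
    {g : Module.End S M} (hg : Function.Injective g) : Function.Bijective g := by
  obtain ⟨r, hr⟩ := Module.Injective.out g hg LinearMap.id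
  have := hM.1
  have hrange : LinearMap.range g ≠ ⊥ := LinearMap.range_ne_bot_of_injective hg
  have hker : LinearMap.ker r = ⊥ := by
    by_contra h
    refine hM.inf_ne_bot hrange h (disjoint_iff.1 (Submodule.disjoint_def.2 ?_))
    rintro _ ⟨y, rfl⟩ hy
    have hy0 : y = 0 := (hr y).symm.trans hy
    rw [hy0, map_zero]
  exact ⟨hg, fun x ↦ ⟨r x, LinearMap.ker_eq_bot.1 hker (hr (r x))⟩⟩

/-- A homomorphism from a monoform module to a uniform module containing a copy of it is zero or
injective. -/
theorem IsMonoform.eq_zero_or_injective {S : Type u} [Ring S] {H : Type v} [AddCommGroup H]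
    [Module S H] (hH : IsMonoform S H) {E : Type w} [AddCommGroup E] [Module S E]
    (hE : ∀ A B : Submodule S E, A ≠ ⊥ → B ≠ ⊥ → A ⊓ B ≠ ⊥)
    {j : H →ₗ[S] E} (hj : Function.Injective j) (f : H →ₗ[S] E) :
    f = 0 ∨ Function.Injective f := by
  by_contra! ⟨hf0, hfinj⟩
  have hker : LinearMap.ker f ≠ ⊥ := fun h ↦ hfinj (LinearMap.ker_eq_bot.1 h)
  have := hH.1
  have hjrange : LinearMap.range j ≠ ⊥ := LinearMap.range_ne_bot_of_injective hj
  have hfrange : LinearMap.range f ≠ ⊥ := fun h ↦ hf0 (LinearMap.range_eq_bot.1 h)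
  obtain ⟨_, ⟨⟨x, rfl⟩, hxf⟩, hx⟩ :=
    (Submodule.ne_bot_iff _).1 (hE _ _ hjrange hfrange)
  let C := (LinearMap.range f).comap j
  let jC : C →ₗ[S] LinearMap.range f := j.restrict fun _ h ↦ h
  have hjC : Function.Injective jC := fun a b hab ↦
    Subtype.ext (hj (congrArg Subtype.val hab))
  refine hH.2 _ hker ⟨C, f.quotKerEquivRange.symm.toLinearMap ∘ₗ jC, ?_,
    f.quotKerEquivRange.symm.injective.comp hjC⟩
  refine (Submodule.ne_bot_iff _).2 ⟨x, hxf, ?_⟩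
  rintro rfl
  exact hx (map_zero j)

/-- Let `H` be a monoform right `R`-module over a right noetherian ring `R`, and let `E` be a
nonzero indecomposable injective right `R`-module containing a submodule isomorphic to `H`.
Any homomorphism `f : H → E` is zero or injective, and its image lies in the unique maximal
monoform submodule `H_E` of `E`. -/
theorem hom_from_monoform_into_maximal_monoform (R : Type u) [Ring R] [IsNoetherianRing Rᵐᵒᵖ]
    (H : Type v) [AddCommGroup H] [Module Rᵐᵒᵖ H] (hH : IsMonoform Rᵐᵒᵖ H)
    (E : Type v) [AddCommGroup E] [Module Rᵐᵒᵖ E] [Module.Injective Rᵐᵒᵖ E]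
    (hE : IsIndecomposableModule Rᵐᵒᵖ E)
    (j : H →ₗ[Rᵐᵒᵖ] E) (hj : Function.Injective j)
    (HE : Submodule Rᵐᵒᵖ E)
    (hHE : HE = ⨅ f ∈ {f : Module.End Rᵐᵒᵖ E | ¬ Function.Bijective f}, LinearMap.ker f)
    (f : H →ₗ[Rᵐᵒᵖ] E) :
    (f = 0 ∨ Function.Injective f) ∧ LinearMap.range f ≤ HE := by
  have hU : ∀ A B : Submodule Rᵐᵒᵖ E, A ≠ ⊥ → B ≠ ⊥ → A ⊓ B ≠ ⊥ := fun _ _ ↦ hE.inf_ne_bot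
  have hf := hH.eq_zero_or_injective hU hj f
  refine ⟨hf, ?_⟩
  rw [hHE]
  refine le_iInf₂ fun g hg ↦ ?_
  rw [LinearMap.range_le_ker_iff]
  refine (hH.eq_zero_or_injective hU hj (g ∘ₗ f)).resolve_right fun hgf ↦ ?_
  have hker : LinearMap.ker g ≠ ⊥ := fun h ↦
    hg (hE.bijective_of_injective (LinearMap.ker_eq_bot.1 h))
  have := hH.1
  have hrange : LinearMap.range f ≠ ⊥ :=
    LinearMap.range_ne_bot_of_injective (Function.Injective.of_comp (f := g) hgf)
  refine hU _ _ hrange hker (disjoint_iff.1 (Submodule.disjoint_def.2 ?_))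
  rintro _ ⟨x, rfl⟩ hx
  have hx0 : x = 0 := hgf (by rw [map_zero]; exact hx)
  rw [hx0, map_zero]
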